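/- Let μ ∈ ℂ and A_μ = {η ∈ ℂ : η² = μ}. Define the entire functions R_{μ,1}(η) = ∑_{n=0}^∞ ((μ − 2n)/n!)·((−(μ+1)/4)_n/((1/2)_n))·η^{2n} and R_{μ,2}(η) = η + (1/4)·∑_{n=1}^∞ ((2n+1−μ)/n!)·(((5−μ)/4)_{n−1}/((3/2)_n))·η^{2n+1}, and set Y_{μ,1}(η) = (e^{−η²/2}/(μ−η²)²)·R_{μ,1}(η), Y_{μ,2}(η) = (e^{−η²/2}/(μ−η²)²)·R_{μ,2}(η) for η ∈ ℂ∖A_μ. Then every function Y : ℂ∖A_μ → ℂ that is complex differentiable to second order on ℂ∖A_μ and satisfies (μ−η²)·Y''(η) − 6η·Y'(η) + ((μ−η²)² − 6)·Y(η) = 0 for all η ∈ ℂ∖A_μ can be written as Y(η) = c₁·Y_{μ,1}(η) + c₂·Y_{μ,2}(η) on ℂ∖A_μ for some constants c₁, c₂ ∈ ℂ. -/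

import Mathlib

open Complex

/-- Rising Pochhammer symbol in `ℂ`. -/
noncomputable def pochC (x : ℂ) (n : ℕ) : ℂ := ∏ i ∈ Finset.range n, (x + (i : ℂ))

/-- The even entire function `R_{μ,1}`. -/
noncomputable def Rmu1 (μ η : ℂ) : ℂ :=
  ∑' n : ℕ, (μ - 2 * (n : ℂ)) / (n.factorial : ℂ)
    * (pochC (-(μ + 1) / 4) n / pochC (1 / 2) n) * η ^ (2 * n)

/-- The odd entire function `R_{μ,2}` (the series over `n ≥ 1` is reindexed by `n ↦ n + 1`). -/
noncomputable def Rmu2 (μ η : ℂ) : ℂ :=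
  η + (1 / 4) * ∑' n : ℕ,
    (2 * ((n : ℂ) + 1) + 1 - μ) / ((n + 1).factorial : ℂ)
      * (pochC ((5 - μ) / 4) n / pochC (3 / 2) (n + 1)) * η ^ (2 * (n + 1) + 1)

noncomputable def Ymu1 (μ η : ℂ) : ℂ :=
  Complex.exp (-η ^ 2 / 2) / (μ - η ^ 2) ^ 2 * Rmu1 μ η

noncomputable def Ymu2 (μ η : ℂ) : ℂ :=
  Complex.exp (-η ^ 2 / 2) / (μ - η ^ 2) ^ 2 * Rmu2 μ η

open Filter Topology

theorem pochC_succ (x : ℂ) (n : ℕ) : pochC x (n + 1) = pochC x n * (x + n) :=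
  Finset.prod_range_succ _ _

theorem pochC_succ' (x : ℂ) (n : ℕ) : pochC x (n + 1) = x * pochC (x + 1) n := by
  unfold pochC
  rw [Finset.prod_range_succ']
  simp only [Nat.cast_zero, add_zero, Nat.cast_add, Nat.cast_one]
  rw [mul_comm]
  congr 1
  exact Finset.prod_congr rfl fun i _ => by ring

theorem pochC_ne_zero {b : ℂ} (hb : ∀ n : ℕ, b + n ≠ 0) (n : ℕ) : pochC b n ≠ 0 :=
  Finset.prod_ne_zero_iff.mpr fun i _ => hb i

/-- The `n`-th Taylor coefficient of Kummer's function `M(a, b, ·)`. -/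
noncomputable def kummerCoeff (a b : ℂ) (n : ℕ) : ℂ :=
  pochC a n / (pochC b n * (n.factorial : ℂ))

/-- Kummer's confluent hypergeometric function. -/
noncomputable def kummerM (a b z : ℂ) : ℂ := ∑' n : ℕ, kummerCoeff a b n * z ^ n

theorem kummerCoeff_zero (a b : ℂ) : kummerCoeff a b 0 = 1 := by
  simp [kummerCoeff, pochC]

theorem kummerCoeff_succ (a : ℂ) {b : ℂ} (hb : ∀ n : ℕ, b + n ≠ 0) (n : ℕ) :
    kummerCoeff a b (n + 1) =
      (a + n) / (b + n) * (1 / ((n : ℂ) + 1)) * kummerCoeff a b n := by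
  have h1 := pochC_ne_zero hb n
  have h2 := hb n
  have h3 : (n : ℂ) + 1 ≠ 0 := Nat.cast_add_one_ne_zero n
  have h4 : (n.factorial : ℂ) ≠ 0 := Nat.cast_ne_zero.mpr n.factorial_ne_zero
  simp only [kummerCoeff, pochC_succ, Nat.factorial_succ]
  push_cast
  field_simp

theorem succ_mul_kummerCoeff_succ (a : ℂ) {b : ℂ} (hb : ∀ n : ℕ, b + n ≠ 0) (n : ℕ) :
    ((n : ℂ) + 1) * kummerCoeff a b (n + 1) = a / b * kummerCoeff (a + 1) (b + 1) n := by
  have h2 : b ≠ 0 := by simpa using hb 0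
  have h1 : pochC (b + 1) n ≠ 0 := by
    have := pochC_ne_zero hb (n + 1)
    rw [pochC_succ'] at this
    exact right_ne_zero_of_mul this
  have h3 : (n : ℂ) + 1 ≠ 0 := Nat.cast_add_one_ne_zero n
  have h4 : (n.factorial : ℂ) ≠ 0 := Nat.cast_ne_zero.mpr n.factorial_ne_zero
  simp only [kummerCoeff, pochC_succ', Nat.factorial_succ]
  push_cast
  field_simp

theorem tendsto_add_natCast_div_add_natCast (a b : ℂ) :
    Tendsto (fun n : ℕ => (a + n) / (b + n)) atTop (𝓝 1) := by
  have hinv : Tendsto (fun n : ℕ => ((n : ℂ))⁻¹) atTop (𝓝 0) :=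
    tendsto_inv₀_cobounded.comp tendsto_natCast_atTop_cobounded
  have h (c : ℂ) : Tendsto (fun n : ℕ => c * (n : ℂ)⁻¹ + 1) atTop (𝓝 1) := by
    simpa using (hinv.const_mul c).add_const 1
  have h' := (h a).div (h b) one_ne_zero
  rw [div_one] at h'
  refine h'.congr' ?_
  filter_upwards [eventually_ne_atTop 0] with n hn
  have hn' : (n : ℂ) ≠ 0 := Nat.cast_ne_zero.mpr hn
  simp only [Pi.div_apply]
  rw [← mul_div_mul_right (a + (n : ℂ)) _ (inv_ne_zero hn'), add_mul, add_mul,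
    mul_inv_cancel₀ hn']

theorem summable_norm_kummerCoeff (a : ℂ) {b : ℂ} (hb : ∀ n : ℕ, b + n ≠ 0) (z : ℂ) :
    Summable fun n : ℕ => ‖kummerCoeff a b n * z ^ n‖ := by
  have h1 : Tendsto (fun n : ℕ => (a + n) / (b + n) * (1 / ((n : ℂ) + 1)) * z) atTop (𝓝 0) := by
    simpa using ((tendsto_add_natCast_div_add_natCast a b).mul
      (tendsto_one_div_add_atTop_nhds_zero_nat (𝕜 := ℂ))).mul_const z
  have h2 := h1.norm
  rw [norm_zero] at h2
  refine summable_of_ratio_norm_eventually_le (r := 1 / 2) (by norm_num) ?_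
  filter_upwards [h2.eventually_le_const (show (0 : ℝ) < 1 / 2 by norm_num)] with n hn
  rw [norm_norm, norm_norm, kummerCoeff_succ a hb, show (a + n) / (b + n) * (1 / ((n : ℂ) + 1)) *
    kummerCoeff a b n * z ^ (n + 1) = ((a + n) / (b + n) * (1 / ((n : ℂ) + 1)) * z) *
    (kummerCoeff a b n * z ^ n) by ring, norm_mul]
  gcongr

theorem hasSum_kummerM (a : ℂ) {b : ℂ} (hb : ∀ n : ℕ, b + n ≠ 0) (z : ℂ) :
    HasSum (fun n : ℕ => kummerCoeff a b n * z ^ n) (kummerM a b z) :=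
  (summable_norm_kummerCoeff a hb z).of_norm.hasSum

theorem kummerM_zero (a b : ℂ) : kummerM a b 0 = 1 := by
  unfold kummerM
  rw [tsum_eq_single 0 fun n hn => by simp [hn]]
  simp [kummerCoeff_zero]

theorem norm_kummerCoeff_mul_pow_le (a b : ℂ) {r : ℝ} (n : ℕ) {w : ℂ}
    (hw : w ∈ Metric.ball (0 : ℂ) r) :
    ‖kummerCoeff a b n * w ^ n‖ ≤ ‖kummerCoeff a b n * (r : ℂ) ^ n‖ := by
  have hw' : ‖w‖ < r := by simpa using hw
  have hr : 0 ≤ r := (norm_nonneg w).trans hw'.le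
  simp only [norm_mul, norm_pow, Complex.norm_real, Real.norm_of_nonneg hr]
  gcongr

theorem differentiable_kummerM (a : ℂ) {b : ℂ} (hb : ∀ n : ℕ, b + n ≠ 0) :
    Differentiable ℂ (kummerM a b) := fun z =>
  (differentiableOn_tsum_of_summable_norm
    (summable_norm_kummerCoeff a hb ((‖z‖ + 1 : ℝ) : ℂ)) (fun _ => by fun_prop)
    Metric.isOpen_ball fun n _ hw => norm_kummerCoeff_mul_pow_le a b n hw).differentiableAt
    (Metric.isOpen_ball.mem_nhds (by simp))

theorem hasSum_deriv_kummerM (a : ℂ) {b : ℂ} (hb : ∀ n : ℕ, b + n ≠ 0) (z : ℂ) :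
    HasSum (fun n : ℕ => kummerCoeff a b n * (n * z ^ (n - 1))) (deriv (kummerM a b) z) := by
  have h := hasSum_deriv_of_summable_norm
    (summable_norm_kummerCoeff a hb ((‖z‖ + 1 : ℝ) : ℂ)) (fun n => by fun_prop)
    Metric.isOpen_ball (fun n _ hw => norm_kummerCoeff_mul_pow_le a b n hw)
    (show z ∈ Metric.ball (0 : ℂ) (‖z‖ + 1) by simp)
  rw [show kummerM a b = fun w => ∑' n : ℕ, kummerCoeff a b n * w ^ n from rfl]
  simpa using h

theorem hasSum_mul_deriv_kummerM (a : ℂ) {b : ℂ} (hb : ∀ n : ℕ, b + n ≠ 0) (z : ℂ) :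
    HasSum (fun n : ℕ => (n : ℂ) * (kummerCoeff a b n * z ^ n)) (z * deriv (kummerM a b) z) := by
  refine ((hasSum_deriv_kummerM a hb z).mul_left z).congr_fun ?_
  rintro (_ | n)
  · simp
  · simp only [Nat.add_sub_cancel]
    ring

/-- The function `P` with `∂M/∂z = a P`, well behaved also at `a = 0`. -/
noncomputable def kummerP (a b z : ℂ) : ℂ := kummerM (a + 1) (b + 1) z / b

theorem add_one_add_natCast_ne_zero {b : ℂ} (hb : ∀ n : ℕ, b + n ≠ 0) (n : ℕ) :
    b + 1 + n ≠ 0 := by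
  have := hb (n + 1)
  push_cast at this
  rwa [add_assoc, add_comm 1 (n : ℂ)]

theorem hasDerivAt_kummerM (a : ℂ) {b : ℂ} (hb : ∀ n : ℕ, b + n ≠ 0) (z : ℂ) :
    HasDerivAt (kummerM a b) (a * kummerP a b z) z := by
  have h1 := (hasSum_nat_add_iff' 1).mpr (hasSum_deriv_kummerM a hb z)
  have h2 := (hasSum_kummerM (a + 1) (add_one_add_natCast_ne_zero hb) z).mul_left (a / b)
  have h3 : deriv (kummerM a b) z = a * kummerP a b z := by
    have := h1.unique (h2.congr_fun fun n => ?_)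
    · simp only [Finset.range_one, Finset.sum_singleton, Nat.cast_zero, zero_mul, mul_zero,
        sub_zero] at this
      rw [this, kummerP]
      ring
    · rw [← mul_assoc (a / b), ← succ_mul_kummerCoeff_succ a hb]
      simp only [Nat.add_sub_cancel]
      push_cast
      ring
  exact h3 ▸ (differentiable_kummerM a hb z).hasDerivAt

theorem mul_deriv_kummerP (a : ℂ) {b : ℂ} (hb : ∀ n : ℕ, b + n ≠ 0) (z : ℂ) :
    z * deriv (kummerP a b) z = kummerM a b z - (b - z) * kummerP a b z := by
  have hb0 : b ≠ 0 := by simpa using hb 0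
  have hb1 := add_one_add_natCast_ne_zero hb
  have hd : deriv (kummerP a b) z = deriv (kummerM (a + 1) (b + 1)) z / b := by
    unfold kummerP
    exact deriv_div_const _
  have h1 := (hasSum_mul_deriv_kummerM (a + 1) hb1 z).div_const b
  have h2 := hasSum_kummerM (a + 1) hb1 z
  have h3 := (hasSum_nat_add_iff' 1).mpr (h1.add h2)
  have h4 := (hasSum_nat_add_iff' 1).mpr (hasSum_kummerM a hb z)
  have h5 := h3.unique (((h2.mul_left (z / b)).add h4).congr_fun fun n => ?_)
  · simp only [Finset.range_one, Finset.sum_singleton, kummerCoeff_zero] at h5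
    rw [hd, kummerP]
    simp at h5
    field_simp at h5 ⊢
    linear_combination h5
  · have e1 := kummerCoeff_succ (a + 1) hb1 n
    have e2 := succ_mul_kummerCoeff_succ a hb n
    have h6 := hb1 n
    have h7 : (n : ℂ) + 1 ≠ 0 := Nat.cast_add_one_ne_zero n
    have e3 : kummerCoeff a b (n + 1) = a / b * kummerCoeff (a + 1) (b + 1) n / (n + 1) := by
      rw [← e2]; field_simp
    rw [e1, e3]
    push_cast
    field_simp
    ring

theorem hasDerivAt_kummerP (a : ℂ) {b : ℂ} (hb : ∀ n : ℕ, b + n ≠ 0) (z : ℂ) :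
    HasDerivAt (kummerP a b) (deriv (kummerP a b) z) z :=
  ((differentiable_kummerM (a + 1) (add_one_add_natCast_ne_zero hb)).div_const b z).hasDerivAt

theorem half_add_natCast_ne_zero (n : ℕ) : (1 / 2 : ℂ) + n ≠ 0 := by
  intro h
  have h' : ((1 / 2 + n : ℝ) : ℂ) = 0 := by push_cast; exact h
  have : (1 / 2 + n : ℝ) ≠ 0 := by positivity
  exact this (by exact_mod_cast h')

theorem three_halves_add_natCast_ne_zero (n : ℕ) : (3 / 2 : ℂ) + n ≠ 0 := by
  have := add_one_add_natCast_ne_zero half_add_natCast_ne_zero n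
  norm_num at this ⊢
  exact this

theorem Rmu1_eq (μ η : ℂ) :
    Rmu1 μ η = μ * kummerM (-(μ + 1) / 4) (1 / 2) (η ^ 2)
      + (μ + 1) / 2 * (η ^ 2 * kummerP (-(μ + 1) / 4) (1 / 2) (η ^ 2)) := by
  have h1 := (hasSum_kummerM (-(μ + 1) / 4) half_add_natCast_ne_zero (η ^ 2)).mul_left μ
  have h2 := (hasSum_mul_deriv_kummerM (-(μ + 1) / 4) half_add_natCast_ne_zero (η ^ 2)).mul_left 2
  rw [(hasDerivAt_kummerM (-(μ + 1) / 4) half_add_natCast_ne_zero (η ^ 2)).deriv] at h2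
  have h3 : Rmu1 μ η = _ := ((h1.sub h2).congr_fun fun n => ?_).tsum_eq
  · rw [h3]
    ring
  · simp only [kummerCoeff, pow_mul, div_eq_mul_inv, mul_inv]
    ring

theorem Rmu2_coeff_eq (μ : ℂ) (n : ℕ) :
    (2 * ((n : ℂ) + 1) + 1 - μ) / ((n + 1).factorial : ℂ)
        * (pochC ((5 - μ) / 4) n / pochC (3 / 2) (n + 1)) =
      4 * kummerCoeff ((1 - μ) / 4) (3 / 2) (n + 1)
        + 4 / 3 * kummerCoeff ((1 - μ) / 4 + 1) (3 / 2 + 1) n := by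
  have hp := pochC_ne_zero (add_one_add_natCast_ne_zero three_halves_add_natCast_ne_zero) n
  have h7 : (n : ℂ) + 1 ≠ 0 := Nat.cast_add_one_ne_zero n
  have h4 : (n.factorial : ℂ) ≠ 0 := Nat.cast_ne_zero.mpr n.factorial_ne_zero
  rw [show (5 - μ) / 4 = (1 - μ) / 4 + 1 by ring]
  simp only [kummerCoeff, pochC_succ', Nat.factorial_succ]
  generalize pochC ((1 - μ) / 4 + 1) n = x
  generalize pochC (3 / 2 + 1) n = y at *
  push_cast
  field_simp
  ring

theorem Rmu2_eq (μ η : ℂ) :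
    Rmu2 μ η = η * (kummerM ((1 - μ) / 4) (3 / 2) (η ^ 2)
      + 1 / 2 * (η ^ 2 * kummerP ((1 - μ) / 4) (3 / 2) (η ^ 2))) := by
  have hb := three_halves_add_natCast_ne_zero
  have h1 := (hasSum_nat_add_iff' 1).mpr (hasSum_kummerM ((1 - μ) / 4) hb (η ^ 2))
  have h2 := hasSum_kummerM ((1 - μ) / 4 + 1) (add_one_add_natCast_ne_zero hb) (η ^ 2)
  have h3 := (h1.mul_left (4 * η)).add (h2.mul_left (4 / 3 * η ^ 3))
  simp only [Finset.range_one, Finset.sum_singleton, kummerCoeff_zero, pow_zero, mul_one] at h3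
  simp only [Rmu2, Rmu2_coeff_eq]
  rw [(h3.congr_fun fun n => by ring).tsum_eq, kummerP]
  ring

/-- The combination whose exponential growth encodes the Wronskian of `R_{μ,1}` and `R_{μ,2}`. -/
theorem kummer_wronskian (μ z : ℂ) :
    kummerM (-(μ + 1) / 4) (1 / 2) z * kummerM ((1 - μ) / 4) (3 / 2) z
      + (μ + 1) / 2 * (z * kummerP (-(μ + 1) / 4) (1 / 2) z) * kummerM ((1 - μ) / 4) (3 / 2) z
      + (1 - μ) / 2 * kummerM (-(μ + 1) / 4) (1 / 2) z * (z * kummerP ((1 - μ) / 4) (3 / 2) z)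
      = exp z := by
  set M := kummerM (-(μ + 1) / 4) (1 / 2)
  set P := kummerP (-(μ + 1) / 4) (1 / 2)
  set N := kummerM ((1 - μ) / 4) (3 / 2)
  set S := kummerP ((1 - μ) / 4) (3 / 2)
  have hd (z : ℂ) : HasDerivAt (fun z => exp (-z) * (M z * N z + (μ + 1) / 2 * (z * P z) * N z
      + (1 - μ) / 2 * M z * (z * S z))) 0 z := by
    have hM := hasDerivAt_kummerM (-(μ + 1) / 4) half_add_natCast_ne_zero z
    have hN := hasDerivAt_kummerM ((1 - μ) / 4) three_halves_add_natCast_ne_zero z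
    have hP := (hasDerivAt_id z).mul (hasDerivAt_kummerP (-(μ + 1) / 4) half_add_natCast_ne_zero z)
    have hS := (hasDerivAt_id z).mul
      (hasDerivAt_kummerP ((1 - μ) / 4) three_halves_add_natCast_ne_zero z)
    have eP := mul_deriv_kummerP (-(μ + 1) / 4) half_add_natCast_ne_zero z
    have eS := mul_deriv_kummerP ((1 - μ) / 4) three_halves_add_natCast_ne_zero z
    have h := (hasDerivAt_neg z).cexp.mul
      (((hM.mul hN).add ((hP.const_mul ((μ + 1) / 2)).mul hN)).add ((hM.const_mul ((1 - μ) / 2)).mul hS))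
    refine h.congr_deriv ?_
    simp only [id, Pi.mul_apply, Pi.add_apply]
    linear_combination exp (-z) * ((μ + 1) / 2 * N z * eP + (1 - μ) / 2 * M z * eS)
  have hc := is_const_of_deriv_eq_zero (fun z => (hd z).differentiableAt)
    (fun z => (hd z).deriv) z 0
  simp only [M, N, kummerM_zero, neg_zero, exp_zero, zero_mul, mul_zero, add_zero, mul_one] at hc
  refine mul_left_cancel₀ (exp_ne_zero (-z)) (hc.trans ?_)
  rw [← exp_add, neg_add_cancel, exp_zero]

theorem HasDerivAt.comp_sq {f : ℂ → ℂ} {f' η : ℂ} (hf : HasDerivAt f f' (η ^ 2)) :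
    HasDerivAt (fun x => f (x ^ 2)) (f' * (2 * η)) η := by
  simpa [Function.comp_def] using HasDerivAt.comp η hf (hasDerivAt_pow 2 η)

/-- `R`, with derivative `D`, solves the equation obtained from the substitution
`Y = e^{-η²/2} (μ - η²)⁻² R`. -/
def IsReducedSolution (μ : ℂ) (R D : ℂ → ℂ) : Prop :=
  ∀ η, HasDerivAt R (D η) η ∧ ∃ d, HasDerivAt D d η ∧
    (μ - η ^ 2) * d + 2 * η * (1 - μ + η ^ 2) * D η + (μ + 1) * (μ - η ^ 2 - 2) * R η = 0

/-- The derivative of `R_{μ,1}`. -/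
noncomputable def derivRmu1 (μ η : ℂ) : ℂ :=
  (μ + 1) * η * (kummerM (-(μ + 1) / 4) (1 / 2) (η ^ 2)
    - (μ - 1 - 2 * η ^ 2) / 2 * kummerP (-(μ + 1) / 4) (1 / 2) (η ^ 2))

/-- The derivative of `R_{μ,2}`. -/
noncomputable def derivRmu2 (μ η : ℂ) : ℂ :=
  (1 + η ^ 2) * kummerM ((1 - μ) / 4) (3 / 2) (η ^ 2)
    + (1 / 2 + η ^ 2 - μ / 2) * (η ^ 2 * kummerP ((1 - μ) / 4) (3 / 2) (η ^ 2))

theorem isReducedSolution_Rmu1 (μ : ℂ) : IsReducedSolution μ (Rmu1 μ) (derivRmu1 μ) := by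
  intro η
  have hM := (hasDerivAt_kummerM (-(μ + 1) / 4) half_add_natCast_ne_zero (η ^ 2)).comp_sq
  have hP := (hasDerivAt_kummerP (-(μ + 1) / 4) half_add_natCast_ne_zero (η ^ 2)).comp_sq
  have eP := mul_deriv_kummerP (-(μ + 1) / 4) half_add_natCast_ne_zero (η ^ 2)
  have hη := hasDerivAt_id' η
  have hη2 := (hasDerivAt_id' η).pow 2
  rw [show Rmu1 μ = _ from funext (Rmu1_eq μ)]
  refine ⟨((hM.const_mul μ).add ((hη2.mul hP).const_mul ((μ + 1) / 2))).congr_deriv ?_, _,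
    (hη.const_mul (μ + 1)).mul (hM.sub ((((hη2.const_mul 2).const_sub (μ - 1)).div_const 2).mul hP)),
    ?_⟩
  · simp only [derivRmu1, Pi.pow_apply, Nat.cast_ofNat, Nat.add_one_sub_one, pow_one, mul_one]
    linear_combination (μ + 1) * η * eP
  · simp only [derivRmu1, Pi.pow_apply, Nat.cast_ofNat, Nat.add_one_sub_one, pow_one, mul_one]
    linear_combination (μ - η ^ 2) * (μ + 1) * (1 - μ + 2 * η ^ 2) * eP

theorem isReducedSolution_Rmu2 (μ : ℂ) : IsReducedSolution μ (Rmu2 μ) (derivRmu2 μ) := by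
  intro η
  have hM := (hasDerivAt_kummerM ((1 - μ) / 4) three_halves_add_natCast_ne_zero (η ^ 2)).comp_sq
  have hP := (hasDerivAt_kummerP ((1 - μ) / 4) three_halves_add_natCast_ne_zero (η ^ 2)).comp_sq
  have eP := mul_deriv_kummerP ((1 - μ) / 4) three_halves_add_natCast_ne_zero (η ^ 2)
  have hη := hasDerivAt_id' η
  have hη2 := (hasDerivAt_id' η).pow 2
  rw [show Rmu2 μ = _ from funext (Rmu2_eq μ)]
  refine ⟨(hη.mul (hM.add ((hη2.mul hP).const_mul (1 / 2)))).congr_deriv ?_, _,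
    ((hη2.const_add 1).mul hM).add (((hη2.const_add (1 / 2)).sub_const (μ / 2)).mul (hη2.mul hP)),
    ?_⟩
  · simp only [derivRmu2, Pi.mul_apply, Pi.add_apply, Pi.pow_apply, Nat.cast_ofNat,
      Nat.add_one_sub_one, pow_one, mul_one]
    linear_combination η ^ 2 * eP
  · simp only [derivRmu2, Pi.pow_apply, Nat.cast_ofNat, Nat.add_one_sub_one, pow_one, mul_one]
    linear_combination (μ - η ^ 2) * (1 / 2 + η ^ 2 - μ / 2) * 2 * η * eP

theorem wronskian_Rmu (μ η : ℂ) :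
    Rmu1 μ η * derivRmu2 μ η - derivRmu1 μ η * Rmu2 μ η = (μ - η ^ 2) * exp (η ^ 2) := by
  rw [← kummer_wronskian μ, Rmu1_eq, Rmu2_eq, derivRmu1, derivRmu2]
  ring

theorem isPreconnected_sq_ne (μ : ℂ) : IsPreconnected {η : ℂ | η ^ 2 ≠ μ} := by
  have hfin : {η : ℂ | η ^ 2 = μ}.Finite := by
    obtain ⟨s, hs⟩ := IsAlgClosed.exists_pow_nat_eq μ two_pos
    refine (Set.toFinite {s, -s}).subset fun η hη => ?_
    exact sq_eq_sq_iff_eq_or_eq_neg.mp (hη.trans hs.symm)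
  exact (hfin.countable.isConnected_compl_of_one_lt_rank
    (by simp [Complex.rank_real_complex])).isPreconnected

theorem IsReducedSolution.exists_const {μ : ℂ} {R D : ℂ → ℂ} (hR : IsReducedSolution μ R D)
    {Y : ℂ → ℂ} (hY1 : ∀ η : ℂ, η ^ 2 ≠ μ → DifferentiableAt ℂ Y η)
    (hY2 : ∀ η : ℂ, η ^ 2 ≠ μ → DifferentiableAt ℂ (deriv Y) η)
    (hODE : ∀ η : ℂ, η ^ 2 ≠ μ →
      (μ - η ^ 2) * deriv (deriv Y) η - 6 * η * deriv Y η
        + ((μ - η ^ 2) ^ 2 - 6) * Y η = 0) :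
    ∃ c : ℂ, ∀ η : ℂ, η ^ 2 ≠ μ →
      exp (-η ^ 2 / 2) * ((μ - η ^ 2) * (Y η * D η - deriv Y η * R η - η * (Y η * R η))
        + 4 * (η * (Y η * R η))) = c := by
  have hd (η : ℂ) (h : η ^ 2 ≠ μ) : HasDerivAt (fun η => exp (-η ^ 2 / 2) *
      ((μ - η ^ 2) * (Y η * D η - deriv Y η * R η - η * (Y η * R η))
        + 4 * (η * (Y η * R η)))) 0 η := by
    obtain ⟨hr, d, hdd, hode⟩ := hR η
    have hy := (hY1 η h).hasDerivAt
    have hy' := (hY2 η h).hasDerivAt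
    have hη2 := (hasDerivAt_id' η).pow 2
    have hηYR := (hasDerivAt_id' η).mul (hy.mul hr)
    refine ((hη2.neg.div_const 2).cexp.mul (((hη2.const_sub μ).mul
      (((hy.mul hdd).sub (hy'.mul hr)).sub hηYR)).add (hηYR.const_mul 4))).congr_deriv ?_
    simp
    linear_combination exp (-η ^ 2 / 2) * (Y η * hode - R η * hODE η h)
  have hU : IsOpen {η : ℂ | η ^ 2 ≠ μ} := isOpen_ne_fun (by fun_prop) (by fun_prop)
  exact hU.exists_is_const_of_deriv_eq_zero (isPreconnected_sq_ne μ)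
    (fun η h => (hd η h).differentiableAt.differentiableWithinAt) (fun η h => (hd η h).deriv)

theorem statement3 (μ : ℂ) (Y : ℂ → ℂ)
    (hY1 : ∀ η : ℂ, η ^ 2 ≠ μ → DifferentiableAt ℂ Y η)
    (hY2 : ∀ η : ℂ, η ^ 2 ≠ μ → DifferentiableAt ℂ (deriv Y) η)
    (hODE : ∀ η : ℂ, η ^ 2 ≠ μ →
      (μ - η ^ 2) * deriv (deriv Y) η - 6 * η * deriv Y η
        + ((μ - η ^ 2) ^ 2 - 6) * Y η = 0) :
    ∃ c₁ c₂ : ℂ, ∀ η : ℂ, η ^ 2 ≠ μ → Y η = c₁ * Ymu1 μ η + c₂ * Ymu2 μ η := by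
  obtain ⟨c, hc⟩ := (isReducedSolution_Rmu1 μ).exists_const hY1 hY2 hODE
  obtain ⟨c', hc'⟩ := (isReducedSolution_Rmu2 μ).exists_const hY1 hY2 hODE
  refine ⟨c', -c, fun η h => ?_⟩
  have hq : μ - η ^ 2 ≠ 0 := sub_ne_zero.mpr (Ne.symm h)
  have hW := wronskian_Rmu μ η
  have he : exp (-η ^ 2 / 2) * exp (-η ^ 2 / 2) * exp (η ^ 2) = 1 := by
    rw [← exp_add, ← exp_add, ← exp_zero]
    congr 1
    ring
  rw [Ymu1, Ymu2, ← hc η h, ← hc' η h]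
  generalize exp (-η ^ 2 / 2) = e at *
  field_simp
  linear_combination (-(μ - η ^ 2) ^ 2 * Y η) * he - e ^ 2 * Y η * (μ - η ^ 2) * hW
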